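/- arXiv:1711.08642 — 6 statements merged into one kernel-verified Lean document; each statement's English description precedes it below -/
import Mathlib

section
/- Let x† ∈ ℓ¹ and let (γ_n)_{n∈ℕ} be a nondecreasing sequence of strictly positive real numbers. Define φ(t) = 2 · inf_{n∈ℕ} ( ∑_{k=n+1}^∞ |x†_k| + γ_n t ) for t ≥ 0. Then φ is a well-defined (finite-valued) concave index function on [0,∞): φ(0) = 0, φ is continuous, strictly increasing, and concave on [0,∞). -/
open Filter Topology

section InfimumOfAffine

variable {a γ : ℕ → ℝ}

lemma bddBelow_range_affine (ha : ∀ n, 0 ≤ a n) (hγ : ∀ n, 0 ≤ γ n) {t : ℝ} (ht : 0 ≤ t) :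
    BddBelow (Set.range fun n => a n + γ n * t) :=
  ⟨0, by rintro _ ⟨n, rfl⟩; exact add_nonneg (ha n) (mul_nonneg (hγ n) ht)⟩

lemma iInf_affine_nonneg (ha : ∀ n, 0 ≤ a n) (hγ : ∀ n, 0 ≤ γ n) {t : ℝ} (ht : 0 ≤ t) :
    0 ≤ ⨅ n, (a n + γ n * t) :=
  le_ciInf fun n => add_nonneg (ha n) (mul_nonneg (hγ n) ht)

lemma concaveOn_iInf_affine (ha : ∀ n, 0 ≤ a n) (hγ : ∀ n, 0 ≤ γ n) :
    ConcaveOn ℝ (Set.Ici 0) fun t : ℝ => ⨅ n, (a n + γ n * t) := by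
  refine ⟨convex_Ici 0, fun s hs t ht p q hp hq hpq => le_ciInf fun n => ?_⟩
  have h₁ := mul_le_mul_of_nonneg_left (ciInf_le (bddBelow_range_affine ha hγ hs) n) hp
  have h₂ := mul_le_mul_of_nonneg_left (ciInf_le (bddBelow_range_affine ha hγ ht) n) hq
  simp only [smul_eq_mul]
  linear_combination h₁ + h₂ + a n * hpq

lemma strictMonoOn_iInf_affine (ha : ∀ n, 0 ≤ a n) (hγ : Monotone γ) (hγ₀ : 0 < γ 0) :
    StrictMonoOn (fun t : ℝ => ⨅ n, (a n + γ n * t)) (Set.Ici 0) := by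
  intro s hs t _ hst
  have hγ' : ∀ n, 0 ≤ γ n := fun n => hγ₀.le.trans (hγ n.zero_le)
  have hlt : 0 < γ 0 * (t - s) := mul_pos hγ₀ (sub_pos.2 hst)
  refine (lt_add_of_pos_right _ hlt).trans_le (le_ciInf fun n => ?_)
  have h₁ := ciInf_le (bddBelow_range_affine ha hγ' hs) n
  have h₂ := mul_le_mul_of_nonneg_right (hγ n.zero_le) (sub_pos.2 hst).le
  linear_combination h₁ + h₂

lemma iInf_affine_zero (ha : ∀ n, 0 ≤ a n) (hγ : ∀ n, 0 ≤ γ n)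
    (hlim : Tendsto a atTop (𝓝 0)) : ⨅ n, (a n + γ n * 0) = 0 := by
  refine le_antisymm (ge_of_tendsto' hlim fun n => ?_) (iInf_affine_nonneg ha hγ le_rfl)
  simpa using ciInf_le (bddBelow_range_affine ha hγ le_rfl) n

lemma continuousOn_iInf_affine (ha : ∀ n, 0 ≤ a n) (hγ : ∀ n, 0 ≤ γ n)
    (hlim : Tendsto a atTop (𝓝 0)) :
    ContinuousOn (fun t : ℝ => ⨅ n, (a n + γ n * t)) (Set.Ici 0) := by
  intro t ht
  rcases (Set.mem_Ici.1 ht).eq_or_lt with rfl | hpos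
  · rw [ContinuousWithinAt, iInf_affine_zero ha hγ hlim]
    refine tendsto_order.2 ⟨fun b hb => ?_, fun b hb => ?_⟩
    · filter_upwards [self_mem_nhdsWithin] with s hs
      exact hb.trans_le (iInf_affine_nonneg ha hγ hs)
    · obtain ⟨n, hn⟩ := (hlim.eventually_lt_const hb).exists
      have hcont : Tendsto (fun s : ℝ => a n + γ n * s) (𝓝[Set.Ici 0] 0) (𝓝 (a n + γ n * 0)) :=
        (by fun_prop : Continuous fun s : ℝ => a n + γ n * s).continuousWithinAt
      filter_upwards [self_mem_nhdsWithin, hcont.eventually_lt_const (by simpa using hn)]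
        with s hs hlt
      exact (ciInf_le (bddBelow_range_affine ha hγ hs) n).trans_lt hlt
  · have h := (concaveOn_iInf_affine ha hγ).continuousOn_interior
    rw [interior_Ici] at h
    exact (h.continuousAt (Ioi_mem_nhds hpos)).continuousWithinAt

end InfimumOfAffine

/-- For `x† ∈ ℓ¹` and a nondecreasing sequence `γ` of strictly positive reals,
the function `φ(t) = 2 · inf_n (∑_{k>n} |x†_k| + γ_n t)` is a concave index function on `[0,∞)`:
`φ(0) = 0`, `φ` is continuous, strictly increasing and concave on `[0,∞)`. -/
theorem stmt_1 (xdag : lp (fun _ : ℕ => ℝ) 1) (γ : ℕ → ℝ)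
    (hγmono : Monotone γ) (hγpos : ∀ n, 0 < γ n)
    (φ : ℝ → ℝ)
    (hφ : ∀ t : ℝ, φ t = 2 * ⨅ n : ℕ, ((∑' k : ℕ, |(xdag : ℕ → ℝ) (k + n)|) + γ n * t)) :
    φ 0 = 0 ∧ ContinuousOn φ (Set.Ici 0) ∧ StrictMonoOn φ (Set.Ici 0) ∧
      ConcaveOn ℝ (Set.Ici 0) φ := by
  have ha : ∀ n, 0 ≤ ∑' k : ℕ, |(xdag : ℕ → ℝ) (k + n)| :=
    fun n => tsum_nonneg fun _ => abs_nonneg _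
  have hlim : Tendsto (fun n => ∑' k : ℕ, |(xdag : ℕ → ℝ) (k + n)|) atTop (𝓝 0) :=
    tendsto_sum_nat_add fun k => |(xdag : ℕ → ℝ) k|
  have hγ : ∀ n, 0 ≤ γ n := fun n => (hγpos n).le
  obtain rfl : φ = fun t => 2 * ⨅ n : ℕ, ((∑' k : ℕ, |(xdag : ℕ → ℝ) (k + n)|) + γ n * t) :=
    funext hφ
  refine ⟨?_, (continuousOn_iInf_affine ha hγ hlim).const_mul 2, fun s hs t ht hst => ?_,
    (concaveOn_iInf_affine ha hγ).smul zero_le_two⟩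
  · simp only [iInf_affine_zero ha hγ hlim, mul_zero (2 : ℝ)]
  · exact mul_lt_mul_of_pos_left (strictMonoOn_iInf_affine ha hγmono (hγpos 0) hs ht hst) two_pos
end

section
/- Let Z be a separable real Banach space, Y = Z* its (strong) dual, and let A : ℓ¹ → Y be a bounded linear operator that is injective and sequentially weak*-to-weak* continuous. Then the closure, in the supremum norm of ℓ∞, of the set V = { v ∈ ℓ∞ : there exists z ∈ Z with v_k = (A e^{(k)})(z) for all k } equals c₀, the space of real sequences converging to zero. -/
open Filter Topology

/-- The `k`-th standard unit vector in `ℓ¹`. -/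
noncomputable def stdUnit (k : ℕ) : lp (fun _ : ℕ => ℝ) 1 := lp.single 1 k 1

/-- A sequence in `ℓ¹` converges weakly* (duality with the predual `c₀`). -/
def WeakStarTendsto (x : ℕ → lp (fun _ : ℕ => ℝ) 1) (x₀ : lp (fun _ : ℕ => ℝ) 1) : Prop :=
  ∀ u : ℕ → ℝ, Tendsto u atTop (nhds 0) →
    Tendsto (fun n => ∑' k : ℕ, (x n : ℕ → ℝ) k * u k) atTop
      (nhds (∑' k : ℕ, (x₀ : ℕ → ℝ) k * u k))

/-- The null sequences form a closed subset of `ℓ∞`. -/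
theorem isClosed_setOf_tendsto_zero :
    IsClosed {v : lp (fun _ : ℕ => ℝ) ⊤ | Tendsto (v : ℕ → ℝ) atTop (nhds 0)} := by
  refine isClosed_of_closure_subset fun v hv => ?_
  rw [Metric.mem_closure_iff] at hv
  refine Metric.tendsto_atTop.2 fun ε hε => ?_
  obtain ⟨b, hb, hvb⟩ := hv (ε / 2) (half_pos hε)
  obtain ⟨N, hN⟩ := Metric.tendsto_atTop.1 hb (ε / 2) (half_pos hε)
  refine ⟨N, fun n hn => ?_⟩
  have h₁ : ‖(v - b : lp (fun _ : ℕ => ℝ) ⊤) n‖ ≤ ‖v - b‖ :=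
    lp.norm_apply_le_norm ENNReal.top_ne_zero _ n
  rw [lp.coeFn_sub, Pi.sub_apply, ← dist_eq_norm, ← dist_eq_norm] at h₁
  have h₂ := hN n hn
  have h₃ := dist_triangle ((v : ℕ → ℝ) n) ((b : ℕ → ℝ) n) 0
  linarith

/-- The coordinates of a finite sum of multiples of unit vectors. -/
theorem lp_sum_single_apply (s : Finset ℕ) (c : ℕ → ℝ) (i : ℕ) :
    (∑ k ∈ s, lp.single ⊤ k (c k) : lp (fun _ : ℕ => ℝ) ⊤) i = if i ∈ s then c i else 0 := by
  simp only [lp.coeFn_sum, lp.coeFn_single, Finset.sum_apply, Finset.sum_pi_single]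

/-- A null sequence is the sum in `ℓ∞` of its coordinates along the unit vectors. -/
theorem hasSum_single_of_tendsto_zero {v : lp (fun _ : ℕ => ℝ) ⊤}
    (hv : Tendsto (v : ℕ → ℝ) atTop (nhds 0)) :
    HasSum (fun k => (lp.single ⊤ k ((v : ℕ → ℝ) k) : lp (fun _ : ℕ => ℝ) ⊤)) v := by
  refine Metric.tendsto_atTop.2 fun ε hε => ?_
  obtain ⟨N, hN⟩ := Metric.tendsto_atTop.1 hv (ε / 2) (half_pos hε)
  refine ⟨Finset.range N, fun s hs => ?_⟩
  rw [dist_eq_norm]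
  refine lt_of_le_of_lt (lp.norm_le_of_forall_le (half_pos hε).le fun i => ?_) (half_lt_self hε)
  rw [lp.coeFn_sub, Pi.sub_apply, lp_sum_single_apply]
  split_ifs with hi
  · simpa using (half_pos hε).le
  · have hNi : N ≤ i := not_lt.1 fun h => hi (hs (Finset.mem_range.2 h))
    have := hN i hNi
    rw [dist_zero_right] at this
    simpa using this.le

/-- The values of a bounded functional on `ℓ∞` at the unit vectors are absolutely summable. -/
theorem summable_abs_apply_single (f : lp (fun _ : ℕ => ℝ) ⊤ →L[ℝ] ℝ) :
    Summable fun k => |f (lp.single ⊤ k 1)| := by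
  refine summable_of_sum_le (c := ‖f‖) (fun _ => abs_nonneg _) fun s => ?_
  have hnorm : ‖(∑ k ∈ s, lp.single ⊤ k (SignType.sign (f (lp.single ⊤ k 1)) : ℝ) :
      lp (fun _ : ℕ => ℝ) ⊤)‖ ≤ 1 := by
    refine lp.norm_le_of_forall_le zero_le_one fun i => ?_
    rw [lp_sum_single_apply s fun k => (SignType.sign (f (lp.single ⊤ k 1)) : ℝ)]
    split_ifs
    · rcases lt_trichotomy (f (lp.single ⊤ i 1)) 0 with h | h | h <;> simp [h]
    · simp
  have hsum : f (∑ k ∈ s, lp.single ⊤ k (SignType.sign (f (lp.single ⊤ k 1)) : ℝ)) =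
      ∑ k ∈ s, |f (lp.single ⊤ k 1)| := by
    rw [map_sum]
    refine Finset.sum_congr rfl fun k _ => ?_
    have := lp.single_smul (E := fun _ : ℕ => ℝ) (𝕜 := ℝ) ⊤ k
      (SignType.sign (f (lp.single ⊤ k 1)) : ℝ) (1 : ℝ)
    rw [smul_eq_mul, mul_one] at this
    rw [this, map_smul, smul_eq_mul, sign_mul_self]
  calc ∑ k ∈ s, |f (lp.single ⊤ k 1)| ≤ ‖f‖ * _ := hsum ▸ (le_abs_self _).trans (f.le_opNorm _)
    _ ≤ ‖f‖ := mul_le_of_le_one_right (norm_nonneg _) hnorm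

/-- The unit vectors of `ℓ¹` tend to zero weakly*. -/
theorem weakStarTendsto_stdUnit : WeakStarTendsto stdUnit 0 := by
  intro u hu
  have h : ∀ n, ∑' k : ℕ, (stdUnit n : ℕ → ℝ) k * u k = u n := fun n => by
    have hcoord : (stdUnit n : ℕ → ℝ) = Pi.single n 1 := rfl
    rw [hcoord, tsum_eq_single n fun k hk => by rw [Pi.single_eq_of_ne hk, zero_mul],
      Pi.single_eq_same, one_mul]
  simpa [h] using hu

/-- A linear functional that is bounded above on a subspace vanishes there. -/
theorem apply_eq_zero_of_forall_lt {E : Type*} [AddCommGroup E] [Module ℝ E]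
    (V : Submodule ℝ E) (f : E →ₗ[ℝ] ℝ) {u : ℝ} (h : ∀ a ∈ V, f a < u) {a : E} (ha : a ∈ V) :
    f a = 0 := by
  by_contra hne
  have := h _ (V.smul_mem (u / f a) ha)
  rw [map_smul, smul_eq_mul, div_mul_cancel₀ _ hne] at this
  exact this.false

/-- if `A : ℓ¹ → Y = Z*` is injective and sequentially weak*-to-weak*
continuous, then the closure in `ℓ∞` of the range of `A*|_Z` (identified with the set of
bounded sequences `([A*z]_k)_k = ((A e^{(k)}) z)_k`) equals `c₀`. -/
theorem stmt_4 {Z : Type*} [NormedAddCommGroup Z] [NormedSpace ℝ Z] [CompleteSpace Z]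
    [TopologicalSpace.SeparableSpace Z]
    (A : lp (fun _ : ℕ => ℝ) 1 →L[ℝ] (Z →L[ℝ] ℝ))
    (hinj : Function.Injective A)
    (hcont : ∀ (x : ℕ → lp (fun _ : ℕ => ℝ) 1) (x₀ : lp (fun _ : ℕ => ℝ) 1),
      WeakStarTendsto x x₀ →
      ∀ z : Z, Tendsto (fun n => (A (x n)) z) atTop (nhds ((A x₀) z))) :
    closure {v : lp (fun _ : ℕ => ℝ) ⊤ | ∃ z : Z, ∀ k : ℕ, (v : ℕ → ℝ) k = (A (stdUnit k)) z}
      = {v : lp (fun _ : ℕ => ℝ) ⊤ | Tendsto (v : ℕ → ℝ) atTop (nhds 0)} := by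
  have htend : ∀ z : Z, Tendsto (fun n => A (stdUnit n) z) atTop (nhds 0) := fun z => by
    simpa using hcont stdUnit 0 weakStarTendsto_stdUnit z
  refine Set.Subset.antisymm (closure_minimal ?_ isClosed_setOf_tendsto_zero) fun v hv => ?_
  · rintro v ⟨z, hz⟩
    exact (htend z).congr fun k => (hz k).symm
  let V : Submodule ℝ (lp (fun _ : ℕ => ℝ) ⊤) :=
    { carrier := {v | ∃ z : Z, ∀ k : ℕ, (v : ℕ → ℝ) k = (A (stdUnit k)) z}
      zero_mem' := ⟨0, fun k => by simp⟩
      add_mem' := by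
        rintro v w ⟨z, hz⟩ ⟨y, hy⟩
        exact ⟨z + y, fun k => by simp [hz, hy]⟩
      smul_mem' := by
        rintro c v ⟨z, hz⟩
        exact ⟨c • z, fun k => by simp [hz]⟩ }
  by_contra hvV
  obtain ⟨f, u, hfu, huv⟩ :=
    geometric_hahn_banach_closed_point V.convex.closure isClosed_closure hvV
  have hfV : ∀ a ∈ V, f a = 0 := fun a ha =>
    apply_eq_zero_of_forall_lt V f.toLinearMap (fun b hb => hfu b (subset_closure hb)) ha
  have hsum := summable_abs_apply_single f
  let x : lp (fun _ : ℕ => ℝ) 1 := ⟨fun k => f (lp.single ⊤ k 1), memℓp_gen (by simpa using hsum)⟩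
  have hf : ∀ w : lp (fun _ : ℕ => ℝ) ⊤, Tendsto (w : ℕ → ℝ) atTop (nhds 0) →
      HasSum (fun k => (w : ℕ → ℝ) k * (x : ℕ → ℝ) k) (f w) := fun w hw => by
    refine ((hasSum_single_of_tendsto_zero hw).mapL f).congr_fun fun k => ?_
    have := lp.single_smul (E := fun _ : ℕ => ℝ) (𝕜 := ℝ) ⊤ k ((w : ℕ → ℝ) k) (1 : ℝ)
    rw [smul_eq_mul, mul_one] at this
    rw [this, map_smul, smul_eq_mul]
  have hAx : A x = 0 := by
    ext z
    have hbdd : Memℓp (fun k => A (stdUnit k) z) ⊤ := memℓp_infty (htend z).norm.bddAbove_range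
    have h₁ := hf ⟨_, hbdd⟩ (htend z)
    rw [hfV ⟨_, hbdd⟩ ⟨z, fun _ => rfl⟩] at h₁
    have h₂ := ((lp.hasSum_single ENNReal.one_ne_top x).mapL A).mapL
      (ContinuousLinearMap.apply ℝ ℝ z)
    refine h₂.unique (h₁.congr_fun fun k => ?_)
    have := lp.single_smul (E := fun _ : ℕ => ℝ) (𝕜 := ℝ) 1 k ((x : ℕ → ℝ) k) (1 : ℝ)
    rw [smul_eq_mul, mul_one] at this
    rw [this, map_smul, map_smul, smul_eq_mul, mul_comm]
    rfl
  have hx : x = 0 := hinj (hAx.trans (map_zero A).symm)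
  have hfv : f v = 0 := (hf v hv).unique (by simp [hx])
  have hu : f 0 < u := hfu 0 (subset_closure V.zero_mem)
  rw [map_zero] at hu
  linarith
end

section
/- Let Y be a real Banach space, A : ℓ¹ → Y a bounded linear operator, μ ∈ [0,1), and (γ_n)_{n∈ℕ} a real sequence such that for every n ∈ ℕ and every real sequence ξ with ξ_k ∈ [−1,1] for k ≤ n and ξ_k = 0 for k > n there exists f ∈ Y* with f(A e^{(k)}) = ξ_k for k ≤ n, |f(A e^{(k)})| ≤ μ for k > n, and ‖f‖_{Y*} ≤ γ_n. Set β = (1−μ)/(1+μ). Then for all x, x† ∈ ℓ¹ and all n ∈ ℕ the variational source condition estimate β ‖x − x†‖_{ℓ¹} ≤ ‖x‖_{ℓ¹} − ‖x†‖_{ℓ¹} + 2 ∑_{k=n+1}^∞ |x†_k| + 2 γ_n ‖A x − A x†‖_Y holds; in particular β ‖x − x†‖_{ℓ¹} ≤ ‖x‖_{ℓ¹} − ‖x†‖_{ℓ¹} + φ(‖Ax − Ax†‖_Y) with φ(t) = 2 inf_{n∈ℕ} ( ∑_{k=n+1}^∞ |x†_k| + γ_n t ). -/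
open Filter Topology

theorem summable_abs_lp_one (x : lp (fun _ : ℕ => ℝ) 1) :
    Summable fun k => |(x : ℕ → ℝ) k| := by
  simpa using (lp.hasSum_norm (p := 1) (by simp) x).summable

theorem norm_lp_one_eq_sum_add_tsum (x : lp (fun _ : ℕ => ℝ) 1) (n : ℕ) :
    ‖x‖ = ∑ k ∈ Finset.range n, |(x : ℕ → ℝ) k| + ∑' k, |(x : ℕ → ℝ) (k + n)| := by
  rw [(summable_abs_lp_one x).sum_add_tsum_nat_add n]
  simpa using lp.norm_eq_tsum_rpow (p := 1) (by simp) x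

theorem hasSum_mul_apply_stdUnit (g : lp (fun _ : ℕ => ℝ) 1 →L[ℝ] ℝ)
    (x : lp (fun _ : ℕ => ℝ) 1) :
    HasSum (fun k => (x : ℕ → ℝ) k * g (stdUnit k)) (g x) := by
  have h := (lp.hasSum_single (p := 1) ENNReal.one_ne_top x).mapL g
  convert h using 2 with k
  rw [stdUnit, ← smul_eq_mul, ← map_smul, ← lp.single_smul, smul_eq_mul, mul_one]

/-- If a functional on `ℓ¹` is the sign of `x` on the first `n` unit vectors and bounded by `μ` on
the others, then its value at `x` controls the head of `x` up to `μ` times the tail. -/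
theorem sum_abs_le_apply_add_tail (g : lp (fun _ : ℕ => ℝ) 1 →L[ℝ] ℝ)
    (x : lp (fun _ : ℕ => ℝ) 1) (n : ℕ) {μ : ℝ}
    (hhead : ∀ k < n, g (stdUnit k) = SignType.sign ((x : ℕ → ℝ) k))
    (htail : ∀ k, n ≤ k → |g (stdUnit k)| ≤ μ) :
    ∑ k ∈ Finset.range n, |(x : ℕ → ℝ) k| ≤ g x + μ * ∑' k, |(x : ℕ → ℝ) (k + n)| := by
  have hsum := hasSum_mul_apply_stdUnit g x
  have hsplit := hsum.summable.sum_add_tsum_nat_add n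
  rw [hsum.tsum_eq] at hsplit
  have hP : ∑ k ∈ Finset.range n, (x : ℕ → ℝ) k * g (stdUnit k)
      = ∑ k ∈ Finset.range n, |(x : ℕ → ℝ) k| := by
    refine Finset.sum_congr rfl fun k hk => ?_
    rw [hhead k (Finset.mem_range.1 hk), self_mul_sign]
  have hQ : -∑' k, (x : ℕ → ℝ) (k + n) * g (stdUnit (k + n))
      ≤ μ * ∑' k, |(x : ℕ → ℝ) (k + n)| := by
    rw [← tsum_neg, ← tsum_mul_left]
    refine Summable.tsum_le_tsum (fun k => ?_)
      ((summable_nat_add_iff n).2 hsum.summable).neg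
      (((summable_nat_add_iff n).2 (summable_abs_lp_one x)).mul_left μ)
    calc -((x : ℕ → ℝ) (k + n) * g (stdUnit (k + n)))
        ≤ |(x : ℕ → ℝ) (k + n) * g (stdUnit (k + n))| := neg_le_abs _
      _ = |g (stdUnit (k + n))| * |(x : ℕ → ℝ) (k + n)| := by rw [abs_mul, mul_comm]
      _ ≤ μ * |(x : ℕ → ℝ) (k + n)| := by
        gcongr
        exact htail _ (Nat.le_add_left n k)
  linarith

theorem tail_sub_head_le_norm_sub_norm (x y : lp (fun _ : ℕ => ℝ) 1) (n : ℕ) :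
    ∑' k, |((x - y : lp (fun _ : ℕ => ℝ) 1) : ℕ → ℝ) (k + n)|
      - ∑ k ∈ Finset.range n, |((x - y : lp (fun _ : ℕ => ℝ) 1) : ℕ → ℝ) k|
      ≤ ‖x‖ - ‖y‖ + 2 * ∑' k, |(y : ℕ → ℝ) (k + n)| := by
  have hshift (z : lp (fun _ : ℕ => ℝ) 1) : Summable fun k => |(z : ℕ → ℝ) (k + n)| :=
    (summable_nat_add_iff n).2 (summable_abs_lp_one z)
  have hhead : ∑ k ∈ Finset.range n, |(y : ℕ → ℝ) k| ≤ ∑ k ∈ Finset.range n, |(x : ℕ → ℝ) k|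
      + ∑ k ∈ Finset.range n, |((x - y : lp (fun _ : ℕ => ℝ) 1) : ℕ → ℝ) k| := by
    rw [← Finset.sum_add_distrib]
    refine Finset.sum_le_sum fun k _ => ?_
    rw [lp.coeFn_sub, Pi.sub_apply, abs_sub_comm]
    linarith [abs_sub_abs_le_abs_sub ((y : ℕ → ℝ) k) ((x : ℕ → ℝ) k)]
  have htail : ∑' k, |((x - y : lp (fun _ : ℕ => ℝ) 1) : ℕ → ℝ) (k + n)|
      ≤ ∑' k, |(x : ℕ → ℝ) (k + n)| + ∑' k, |(y : ℕ → ℝ) (k + n)| := by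
    rw [← (hshift x).tsum_add (hshift y)]
    refine (hshift (x - y)).tsum_le_tsum (fun k => ?_) ((hshift x).add (hshift y))
    rw [lp.coeFn_sub, Pi.sub_apply]
    exact abs_sub _ _
  rw [norm_lp_one_eq_sum_add_tsum x n, norm_lp_one_eq_sum_add_tsum y n]
  linarith

/-- under the Property-1 assumption with parameters `μ ∈ [0,1)` and `(γ_n)`,
setting `β = (1−μ)/(1+μ)`, the variational source condition estimate
`β‖x − x†‖ ≤ ‖x‖ − ‖x†‖ + 2∑_{k≥n}|x†_k| + 2γ_n‖Ax − Ax†‖` holds for all `x, x†, n`;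
in particular `β‖x − x†‖ ≤ ‖x‖ − ‖x†‖ + φ(‖Ax − Ax†‖)` with
`φ(t) = 2 inf_n (∑_{k≥n}|x†_k| + γ_n t)`.  (0-based indices.) -/
theorem stmt_9 {Y : Type*} [NormedAddCommGroup Y] [NormedSpace ℝ Y] [CompleteSpace Y]
    (A : lp (fun _ : ℕ => ℝ) 1 →L[ℝ] Y)
    (μ : ℝ) (hμ0 : 0 ≤ μ) (hμ1 : μ < 1) (γ : ℕ → ℝ)
    (hprop : ∀ n : ℕ, ∀ ξ : ℕ → ℝ,
      (∀ k < n, ξ k ∈ Set.Icc (-1 : ℝ) 1) → (∀ k, n ≤ k → ξ k = 0) →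
      ∃ f : Y →L[ℝ] ℝ,
        (∀ k < n, f (A (stdUnit k)) = ξ k) ∧
        (∀ k, n ≤ k → |f (A (stdUnit k))| ≤ μ) ∧
        ‖f‖ ≤ γ n) :
    (∀ (x xdag : lp (fun _ : ℕ => ℝ) 1) (n : ℕ),
      ((1 - μ) / (1 + μ)) * ‖x - xdag‖ ≤ ‖x‖ - ‖xdag‖ +
        2 * (∑' k : ℕ, |(xdag : ℕ → ℝ) (k + n)|) + 2 * γ n * ‖A x - A xdag‖) ∧
    (∀ x xdag : lp (fun _ : ℕ => ℝ) 1,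
      ((1 - μ) / (1 + μ)) * ‖x - xdag‖ ≤ ‖x‖ - ‖xdag‖ +
        2 * ⨅ n : ℕ, ((∑' k : ℕ, |(xdag : ℕ → ℝ) (k + n)|) + γ n * ‖A x - A xdag‖)) := by
  have main : ∀ (x xdag : lp (fun _ : ℕ => ℝ) 1) (n : ℕ),
      ((1 - μ) / (1 + μ)) * ‖x - xdag‖ ≤ ‖x‖ - ‖xdag‖ +
        2 * (∑' k : ℕ, |(xdag : ℕ → ℝ) (k + n)|) + 2 * γ n * ‖A x - A xdag‖ := by
    intro x xdag n
    let d : lp (fun _ : ℕ => ℝ) 1 := x - xdag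
    obtain ⟨f, hhead, htail, hnorm⟩ := hprop n
      (fun k => if k < n then (SignType.sign ((d : ℕ → ℝ) k) : ℝ) else 0)
      (fun k hk => by
        rw [if_pos hk]
        cases SignType.sign ((d : ℕ → ℝ) k) <;> norm_num)
      (fun k hk => if_neg hk.not_gt)
    have hP := sum_abs_le_apply_add_tail (f.comp A) d n (μ := μ)
      (fun k hk => by simpa [hk] using hhead k hk) htail
    have hfd : f (A d) ≤ γ n * ‖A x - A xdag‖ := by
      rw [← map_sub]
      exact (le_abs_self _).trans (f.le_of_opNorm_le hnorm _)
    have hG : 0 ≤ γ n * ‖A x - A xdag‖ :=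
      mul_nonneg ((norm_nonneg f).trans hnorm) (norm_nonneg _)
    have hQP := tail_sub_head_le_norm_sub_norm x xdag n
    have hd := norm_lp_one_eq_sum_add_tsum d n
    change ‖x - xdag‖ = _ at hd
    rw [ContinuousLinearMap.comp_apply] at hP
    rw [hd]
    set P := ∑ k ∈ Finset.range n, |(d : ℕ → ℝ) k|
    set Q := ∑' k, |(d : ℕ → ℝ) (k + n)|
    change Q - P ≤ _ at hQP
    have hbeta : (1 - μ) / (1 + μ) * (P + Q) ≤ Q - P + 2 * (γ n * ‖A x - A xdag‖) := by
      rw [div_mul_eq_mul_div, div_le_iff₀ (by linarith)]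
      nlinarith [mul_nonneg hμ0 hG]
    linarith
  refine ⟨main, fun x xdag => ?_⟩
  have h : (((1 - μ) / (1 + μ)) * ‖x - xdag‖ - (‖x‖ - ‖xdag‖)) / 2 ≤
      ⨅ n : ℕ, ((∑' k : ℕ, |(xdag : ℕ → ℝ) (k + n)|) + γ n * ‖A x - A xdag‖) :=
    le_ciInf fun n => by linarith [main x xdag n]
  linarith
end

section
/- Let Z be a separable real Banach space, Y = Z* its (strong) dual, and let A : ℓ¹ → Y be a bounded linear operator that is injective, sequentially weak*-to-weak* continuous, and has closed range in Y. Then for every μ ∈ (0,1) there exists a constant K > 0 such that the Property-1 condition holds with the constant sequence γ_n = K: for every n ∈ ℕ and every real sequence ξ with ξ_k ∈ [−1,1] for k ≤ n and ξ_k = 0 for k > n, there exists f ∈ Y* with f(A e^{(k)}) = ξ_k for all k ≤ n, |f(A e^{(k)})| ≤ μ for all k > n, and ‖f‖_{Y*} ≤ K. -/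
open Filter Topology

/-- Functionals lift through an injective bounded operator with closed range,
with uniformly controlled norm. -/
theorem ContinuousLinearMap.exists_dual_lift_of_injective_of_isClosed_range
    {E F : Type*} [NormedAddCommGroup E] [NormedSpace ℝ E] [CompleteSpace E]
    [NormedAddCommGroup F] [NormedSpace ℝ F] [CompleteSpace F]
    (A : E →L[ℝ] F) (hinj : Function.Injective A) (hclosed : IsClosed (Set.range A)) :
    ∃ C : ℝ, 0 ≤ C ∧ ∀ φ : E →L[ℝ] ℝ, ∃ f : F →L[ℝ] ℝ,
      (∀ x, f (A x) = φ x) ∧ ‖f‖ ≤ ‖φ‖ * C := by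
  let e := A.equivRange hinj hclosed
  refine ⟨‖(e.symm : A.range →L[ℝ] E)‖,
    ContinuousLinearMap.opNorm_nonneg _, fun φ => ?_⟩
  obtain ⟨f, hf, hnorm⟩ :=
    exists_extension_norm_eq A.range (φ.comp (e.symm : A.range →L[ℝ] E))
  refine ⟨f, fun x => ?_, hnorm.trans_le (φ.opNorm_comp_le _)⟩
  exact (hf (e x)).trans (congrArg φ (e.symm_apply_apply x))

/-- A finitely supported sequence with entries in `[-1, 1]` defines a functional on `ℓ¹` of norm
at most one. -/
theorem exists_functional_stdUnit (n : ℕ) (ξ : ℕ → ℝ)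
    (hξ : ∀ k < n, ξ k ∈ Set.Icc (-1 : ℝ) 1) (hξ₀ : ∀ k, n ≤ k → ξ k = 0) :
    ∃ φ : lp (fun _ : ℕ => ℝ) 1 →L[ℝ] ℝ, (∀ k, φ (stdUnit k) = ξ k) ∧ ‖φ‖ ≤ 1 := by
  have happ : ∀ x, (∑ k ∈ Finset.range n, ξ k • lp.evalCLM ℝ (fun _ : ℕ => ℝ) 1 k) x =
      ∑ k ∈ Finset.range n, ξ k * x k := fun x => by
    simp [lp.evalCLM]
  refine ⟨∑ k ∈ Finset.range n, ξ k • lp.evalCLM ℝ (fun _ : ℕ => ℝ) 1 k, fun k => ?_,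
    ContinuousLinearMap.opNorm_le_bound _ zero_le_one fun x => ?_⟩
  · rw [happ]
    simp only [stdUnit, lp.single_apply, Pi.single_apply, mul_ite, mul_one, mul_zero,
      Finset.sum_ite_eq', Finset.mem_range, ite_eq_left_iff, not_lt]
    exact fun h => (hξ₀ k h).symm
  · rw [happ, one_mul, Real.norm_eq_abs]
    calc |∑ k ∈ Finset.range n, ξ k * x k| ≤ ∑ k ∈ Finset.range n, |ξ k * x k| :=
          Finset.abs_sum_le_sum_abs _ _
      _ ≤ ∑ k ∈ Finset.range n, ‖x k‖ := Finset.sum_le_sum fun k hk => by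
          rw [abs_mul, Real.norm_eq_abs]
          exact mul_le_of_le_one_left (abs_nonneg _) (abs_le.2 (hξ k (Finset.mem_range.1 hk)))
      _ ≤ ‖x‖ := by
          simpa using lp.sum_rpow_le_norm_rpow (by simp) x (Finset.range n)

/-- if `A : ℓ¹ → Y = Z*` is injective, sequentially weak*-to-weak*
continuous and has closed range, then for every `μ ∈ (0,1)` Property 1 holds with a
constant sequence `γ_n = K`, `K > 0`.  (Indices are 0-based.) -/
theorem stmt_10 {Z : Type*} [NormedAddCommGroup Z] [NormedSpace ℝ Z] [CompleteSpace Z]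
    [TopologicalSpace.SeparableSpace Z]
    (A : lp (fun _ : ℕ => ℝ) 1 →L[ℝ] (Z →L[ℝ] ℝ))
    (hinj : Function.Injective A)
    (hcont : ∀ (x : ℕ → lp (fun _ : ℕ => ℝ) 1) (x₀ : lp (fun _ : ℕ => ℝ) 1),
      WeakStarTendsto x x₀ →
      ∀ z : Z, Tendsto (fun n => (A (x n)) z) atTop (nhds ((A x₀) z)))
    (hclosed : IsClosed (Set.range A)) :
    ∀ μ : ℝ, 0 < μ → μ < 1 →
      ∃ K : ℝ, 0 < K ∧ ∀ n : ℕ, ∀ ξ : ℕ → ℝ,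
        (∀ k < n, ξ k ∈ Set.Icc (-1 : ℝ) 1) → (∀ k, n ≤ k → ξ k = 0) →
        ∃ f : (Z →L[ℝ] ℝ) →L[ℝ] ℝ,
          (∀ k < n, f (A (stdUnit k)) = ξ k) ∧
          (∀ k, n ≤ k → |f (A (stdUnit k))| ≤ μ) ∧
          ‖f‖ ≤ K := by
  intro μ hμ _
  obtain ⟨C, hC, hlift⟩ := A.exists_dual_lift_of_injective_of_isClosed_range hinj hclosed
  refine ⟨C + 1, by positivity, fun n ξ hξ hξ₀ => ?_⟩
  obtain ⟨φ, hφ, hφ_norm⟩ := exists_functional_stdUnit n ξ hξ hξ₀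
  obtain ⟨f, hf, hf_norm⟩ := hlift φ
  refine ⟨f, fun k _ => (hf _).trans (hφ k), fun k hk => ?_, ?_⟩
  · rw [hf, hφ, hξ₀ k hk, abs_zero]
    exact hμ.le
  · linarith [mul_le_of_le_one_left hC hφ_norm]
end

section
/- Let Y be an infinite dimensional reflexive real Banach space and let A : ℓ¹ → Y be an injective bounded linear operator. Then the operator equation Ax = y is ill-posed of type II: the range R(A) of A is not closed in Y, and every closed linear subspace of Y that is contained in R(A) is finite dimensional. -/
open Filter Topology

/-- Every bounded sequence in a closed subspace of a reflexive space converges weakly in that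
subspace along a given ultrafilter. -/
theorem exists_weak_limit_of_reflexive {Y : Type*} [NormedAddCommGroup Y] [NormedSpace ℝ Y]
    (hrefl : Function.Surjective (NormedSpace.inclusionInDoubleDual ℝ Y))
    (S : Submodule ℝ Y) (hS : IsClosed (S : Set Y)) {ι : Type*} (U : Ultrafilter ι)
    (s : ι → S) (C : ℝ) (hs : ∀ i, ‖s i‖ ≤ C) :
    ∃ y : S, ∀ g : StrongDual ℝ S, Tendsto (fun i => g (s i)) U (𝓝 (g y)) := by
  let F : ι → WeakDual ℝ (StrongDual ℝ Y) := fun i =>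
    StrongDual.toWeakDual (NormedSpace.inclusionInDoubleDual ℝ Y (s i))
  have hF : ∀ i, F i ∈ WeakDual.toStrongDual ⁻¹' Metric.closedBall 0 C := fun i => by
    have h := NormedSpace.double_dual_bound ℝ Y (s i : Y)
    exact (dist_zero_right (NormedSpace.inclusionInDoubleDual ℝ Y (s i))).trans_le
      (h.trans (hs i))
  obtain ⟨G, -, hG⟩ := (WeakDual.isCompact_closedBall (0 : StrongDual ℝ (StrongDual ℝ Y))
    C).ultrafilter_le_nhds (U.map F)
    (le_principal_iff.2 (Ultrafilter.mem_map.2 (Filter.univ_mem' hF)))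
  obtain ⟨y, hy⟩ := hrefl (WeakDual.toStrongDual G)
  have hlim : ∀ f : StrongDual ℝ Y, Tendsto (fun i => f (s i)) U (𝓝 (f y)) := fun f => by
    have h : Tendsto (fun i => F i f) U (𝓝 (G f)) :=
      ((WeakDual.eval_continuous f).tendsto G).comp hG
    have hGf : G f = f y := by
      rw [← WeakDual.toStrongDual_apply, ← hy, NormedSpace.dual_def]
    simpa [F, hGf] using h
  have hyS : y ∈ S := by
    by_contra hyS
    obtain ⟨f, u, hfu, huf⟩ := geometric_hahn_banach_closed_point S.convex hS hyS
    exact absurd (le_of_tendsto' (hlim f) fun i => (hfu _ (s i).2).le) (not_le.2 huf)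
  refine ⟨⟨y, hyS⟩, fun g => ?_⟩
  obtain ⟨f, hf, -⟩ := exists_extension_norm_eq S g
  simpa [← hf] using hlim f

/-- The functional on `ℓ¹` given by a bounded sequence. -/
theorem exists_strongDual_lp_one (σ : ℕ → ℝ) (hσ : ∀ k, |σ k| ≤ 1) :
    ∃ φ : StrongDual ℝ (lp (fun _ : ℕ => ℝ) 1), ∀ x, φ x = ∑' k, σ k * x k :=
  ⟨lp.tsumCLM ℝ ℕ ℝ ∘L lp.mapCLM 1 (fun k => σ k • ContinuousLinearMap.id ℝ ℝ) zero_le_one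
    (fun k => by simpa [norm_smul] using hσ k), fun _ => rfl⟩

theorem hasSum_abs_lp_one (x : lp (fun _ : ℕ => ℝ) 1) : HasSum (fun k => |x k|) ‖x‖ := by
  simpa using lp.hasSum_norm (p := 1) (by simp) x

/-- An infinite-dimensional subspace of `ℓ¹` contains unit vectors with arbitrarily many vanishing
initial coordinates. -/
theorem exists_norm_eq_one_vanishing (X : Submodule ℝ (lp (fun _ : ℕ => ℝ) 1))
    (hX : ¬ FiniteDimensional ℝ X) (N : ℕ) :
    ∃ x ∈ X, ‖x‖ = 1 ∧ ∀ k < N, x k = 0 := by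
  let L : X →ₗ[ℝ] (Fin N → ℝ) :=
    { toFun := fun x k => (x : lp (fun _ : ℕ => ℝ) 1) k
      map_add' := fun _ _ => rfl
      map_smul' := fun _ _ => rfl }
  have hL : ¬ Function.Injective L := fun h => hX (FiniteDimensional.of_injective L h)
  rw [← LinearMap.ker_eq_bot, Submodule.eq_bot_iff] at hL
  push Not at hL
  obtain ⟨x, hx, hx0⟩ := hL
  have hx0' : (x : lp (fun _ : ℕ => ℝ) 1) ≠ 0 := by simpa using hx0
  refine ⟨‖(x : lp (fun _ : ℕ => ℝ) 1)‖⁻¹ • x, X.smul_mem _ x.2, ?_, fun k hk => ?_⟩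
  · rw [norm_smul, norm_inv, norm_norm, inv_mul_cancel₀ (norm_ne_zero_iff.2 hx0')]
  · have : (x : lp (fun _ : ℕ => ℝ) 1) k = 0 := congrFun hx ⟨k, hk⟩
    simp [this]

/-- Gliding hump: an infinite-dimensional subspace of `ℓ¹` contains a sequence of unit vectors
tending to zero coordinatewise on which some bounded functional is bounded away from zero. -/
theorem exists_gliding_hump (X : Submodule ℝ (lp (fun _ : ℕ => ℝ) 1))
    (hX : ¬ FiniteDimensional ℝ X) :
    ∃ (x : ℕ → lp (fun _ : ℕ => ℝ) 1) (φ : StrongDual ℝ (lp (fun _ : ℕ => ℝ) 1)),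
      ∀ n, x n ∈ X ∧ ‖x n‖ = 1 ∧ (∀ k < n, x n k = 0) ∧ 1 / 2 ≤ φ (x n) := by
  choose u huX hu1 hu0 using exists_norm_eq_one_vanishing X hX
  have hM : ∀ N, ∃ M, N < M ∧ 3 / 4 < ∑ k ∈ Finset.range M, |u N k| := fun N => by
    have h := (hasSum_abs_lp_one (u N)).tendsto_sum_nat
    rw [hu1] at h
    exact ((eventually_gt_atTop N).and (h.eventually_const_lt (by norm_num))).exists
  choose M hNM hM using hM
  let b : ℕ → ℕ := fun n => M^[n] 0
  have hb : ∀ n, b (n + 1) = M (b n) := fun n => Function.iterate_succ_apply' M n 0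
  have hbmono : StrictMono b := strictMono_nat_of_lt_succ fun n => hb n ▸ hNM (b n)
  have hσ : ∀ k, ∃ t : ℝ, |t| ≤ 1 ∧ ∀ n, b n ≤ k → k < b (n + 1) →
      t * u (b n) k = |u (b n) k| := fun k => by
    by_cases h : ∃ n, b n ≤ k ∧ k < b (n + 1)
    · obtain ⟨n, hn, hn'⟩ := h
      refine ⟨SignType.sign (u (b n) k), ?_, fun m hm hm' => ?_⟩
      · rcases lt_trichotomy (u (b n) k) 0 with h | h | h <;> simp [h]
      · have h1 := hbmono.lt_iff_lt.1 (hn.trans_lt hm')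
        have h2 := hbmono.lt_iff_lt.1 (hm.trans_lt hn')
        obtain rfl : m = n := by omega
        exact sign_mul_self _
    · exact ⟨0, by simp, fun n hn hn' => absurd ⟨n, hn, hn'⟩ h⟩
  choose σ hσ1 hσ using hσ
  obtain ⟨φ, hφ⟩ := exists_strongDual_lp_one σ hσ1
  refine ⟨fun n => u (b n), φ, fun n => ⟨huX _, hu1 _,
    fun k hk => hu0 _ k (hk.trans_le hbmono.le_apply), ?_⟩⟩
  have habs := hasSum_abs_lp_one (u (b n))
  have hle : ∀ k, |σ k * u (b n) k| ≤ |u (b n) k| := fun k => by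
    rw [abs_mul]
    exact mul_le_of_le_one_left (abs_nonneg _) (hσ1 k)
  have hsum : Summable fun k => σ k * u (b n) k :=
    Summable.of_norm_bounded habs.summable hle
  have hadd := hsum.hasSum.add habs
  rw [← hφ, hu1] at hadd
  have hpart := sum_le_hasSum (Finset.range (M (b n)))
    (fun k _ => by linarith [neg_le_of_abs_le (hle k)]) hadd
  have heq : ∑ k ∈ Finset.range (M (b n)), (σ k * u (b n) k + |u (b n) k|) =
      ∑ k ∈ Finset.range (M (b n)), 2 * |u (b n) k| := Finset.sum_congr rfl fun k hk => by
    rcases lt_or_ge k (b n) with h | h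
    · simp [hu0 _ k h]
    · rw [hσ k n h (by simpa [hb] using hk), two_mul]
  rw [heq, ← Finset.mul_sum] at hpart
  linarith [hM (b n)]

/-- A closed subspace of a reflexive space that is isomorphic to a subspace of `ℓ¹` is finite
dimensional. -/
theorem finiteDimensional_of_reflexive_of_equiv_lp_one {Y : Type*} [NormedAddCommGroup Y]
    [NormedSpace ℝ Y] (hrefl : Function.Surjective (NormedSpace.inclusionInDoubleDual ℝ Y))
    (S : Submodule ℝ Y) (hS : IsClosed (S : Set Y)) (X : Submodule ℝ (lp (fun _ : ℕ => ℝ) 1))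
    (e : X ≃L[ℝ] S) : FiniteDimensional ℝ S := by
  by_contra hfin
  have hX : ¬ FiniteDimensional ℝ X := fun _ =>
    hfin (Module.Finite.equiv e.toLinearEquiv)
  obtain ⟨x, φ, hx⟩ := exists_gliding_hump X hX
  let z : ℕ → X := fun n => ⟨x n, (hx n).1⟩
  let U : Ultrafilter ℕ := hyperfilter ℕ
  have hU : (U : Filter ℕ) ≤ atTop := Nat.hyperfilter_le_atTop
  obtain ⟨y, hy⟩ := exists_weak_limit_of_reflexive hrefl S hS U (fun n => e (z n))
    ‖(e : X →L[ℝ] S)‖ fun n => (e : X →L[ℝ] S).unit_le_opNorm (z n) (hx n).2.1.le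
  have hlim : ∀ ψ : StrongDual ℝ (lp (fun _ : ℕ => ℝ) 1),
      Tendsto (fun n => ψ (x n)) U (𝓝 (ψ (e.symm y))) := fun ψ => by
    simpa [z] using hy (ψ ∘L X.subtypeL ∘L (e.symm : S →L[ℝ] X))
  have hzero : (e.symm y : lp (fun _ : ℕ => ℝ) 1) = 0 := by
    ext k
    have h0 : Tendsto (fun n => x n k) U (𝓝 0) :=
      tendsto_const_nhds.congr' <| ((eventually_gt_atTop k).filter_mono hU).mono
        fun n hn => ((hx n).2.2.1 k hn).symm
    exact tendsto_nhds_unique (hlim (lp.evalCLM ℝ (fun _ : ℕ => ℝ) 1 k)) h0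
  have h := ge_of_tendsto' (hlim φ) fun n => (hx n).2.2.2
  rw [hzero, map_zero] at h
  norm_num at h

theorem not_finiteDimensional_lp_one : ¬ FiniteDimensional ℝ (lp (fun _ : ℕ => ℝ) 1) := by
  intro h
  have hli : LinearIndependent ℝ fun i : ℕ => lp.single (E := fun _ : ℕ => ℝ) 1 i (1 : ℝ) := by
    let L : lp (fun _ : ℕ => ℝ) 1 →ₗ[ℝ] (ℕ → ℝ) :=
      { toFun := fun x => x, map_add' := fun _ _ => rfl, map_smul' := fun _ _ => rfl }
    exact LinearIndependent.of_comp L (Pi.linearIndependent_single_one ℕ ℝ)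
  exact not_finite_iff_infinite.2 inferInstance (LinearIndependent.finite hli)

/-- if `Y` is an infinite dimensional reflexive Banach space and
`A : ℓ¹ → Y` is an injective bounded linear operator, then the equation `Ax = y` is
ill-posed of type II: the range of `A` is not closed, and every closed subspace of `Y`
contained in the range of `A` is finite dimensional. -/
theorem stmt_11 {Y : Type*} [NormedAddCommGroup Y] [NormedSpace ℝ Y] [CompleteSpace Y]
    (hrefl : Function.Surjective (NormedSpace.inclusionInDoubleDual ℝ Y))
    (hinfdim : ¬ FiniteDimensional ℝ Y)
    (A : lp (fun _ : ℕ => ℝ) 1 →L[ℝ] Y) (hinj : Function.Injective A) :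
    ¬ IsClosed (Set.range A) ∧
      ∀ S : Submodule ℝ Y, (S : Set Y) ⊆ Set.range A → IsClosed (S : Set Y) →
        FiniteDimensional ℝ S := by
  have hmain : ∀ S : Submodule ℝ Y, (S : Set Y) ⊆ Set.range A → IsClosed (S : Set Y) →
      FiniteDimensional ℝ S := fun S hSA hS => by
    let X : Submodule ℝ (lp (fun _ : ℕ => ℝ) 1) := S.comap A.toLinearMap
    have hX : IsClosed (X : Set (lp (fun _ : ℕ => ℝ) 1)) := hS.preimage A.continuous
    have : CompleteSpace X := hX.completeSpace_coe
    have : CompleteSpace S := hS.completeSpace_coe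
    let B : X →L[ℝ] S := (A ∘L X.subtypeL).codRestrict S fun x => x.2
    have hB : Function.Injective B := fun x x' h => Subtype.ext (hinj (congrArg Subtype.val h))
    have hB' : Function.Surjective B := fun y => by
      obtain ⟨x, hx⟩ := hSA y.2
      exact ⟨⟨x, by simp [X, hx]⟩, Subtype.ext hx⟩
    exact finiteDimensional_of_reflexive_of_equiv_lp_one hrefl S hS X
      (ContinuousLinearEquiv.ofBijective B (LinearMap.ker_eq_bot.2 hB)
        (LinearMap.range_eq_top.2 hB'))
  refine ⟨fun hcl => not_finiteDimensional_lp_one ?_, hmain⟩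
  have : FiniteDimensional ℝ A.toLinearMap.range := hmain A.toLinearMap.range
    subset_rfl hcl
  exact Module.Finite.equiv (LinearEquiv.ofInjective A.toLinearMap hinj).symm
end

section
/- Let A : ℓ¹ → ℓ¹ be the bounded linear operator (Ax)_k = x_k + x_{k+1}, whose adjoint A* : ℓ∞ → ℓ∞ is given by [A*η]_1 = η_1 and [A*η]_k = η_k + η_{k−1} for k ≥ 2. Then for every n ∈ ℕ and every real sequence ξ with |ξ_k| ≤ 1 for 1 ≤ k ≤ n, there exists a bounded sequence η ∈ ℓ∞ with sup_k |η_k| ≤ n such that η_1 = ξ_1, η_k + η_{k−1} = ξ_k for 2 ≤ k ≤ n, and η_k + η_{k−1} = 0 for all k > n; that is, A*η = (ξ_1, ..., ξ_n, 0, 0, ...). In particular, the paper's Property 1 holds for this operator with μ = 0 and γ_n = n, and every standard unit vector e^{(k)} belongs to the range of A*. -/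
open Filter Topology

/-- The solution `η` of `η 0 = b 0`, `η (k + 1) + η k = b (k + 1)`. -/
def alternatingSolution (b : ℕ → ℝ) : ℕ → ℝ
  | 0 => b 0
  | k + 1 => b (k + 1) - alternatingSolution b k

theorem abs_alternatingSolution_le_sum (b : ℕ → ℝ) (k : ℕ) :
    |alternatingSolution b k| ≤ ∑ i ∈ Finset.range (k + 1), |b i| := by
  induction k with
  | zero => simp [alternatingSolution]
  | succ k ih =>
    rw [Finset.sum_range_succ, alternatingSolution]
    linarith [abs_sub (b (k + 1)) (alternatingSolution b k)]

theorem sum_abs_truncation_le {n : ℕ} {ξ : ℕ → ℝ} (hξ : ∀ k < n, |ξ k| ≤ 1) (s : Finset ℕ) :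
    ∑ i ∈ s, |if i < n then ξ i else 0| ≤ (n : ℝ) := by
  calc ∑ i ∈ s, |if i < n then ξ i else 0|
      ≤ ∑ i ∈ s, if i < n then (1 : ℝ) else 0 := by
        refine Finset.sum_le_sum fun i _ => ?_
        split_ifs with h
        · exact hξ i h
        · simp
    _ = ((s.filter (· < n)).card : ℝ) := by simp
    _ ≤ n := by
        have hsub : s.filter (· < n) ⊆ Finset.range n := fun i hi => by
          simpa using (Finset.mem_filter.mp hi).2
        exact_mod_cast (Finset.card_le_card hsub).trans_eq (Finset.card_range n)

theorem exists_bounded_alternating_solution (n : ℕ) (ξ : ℕ → ℝ) (hξ : ∀ k < n, |ξ k| ≤ 1) :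
    ∃ η : ℕ → ℝ, (∀ k, |η k| ≤ (n : ℝ)) ∧
      η 0 = (if 0 < n then ξ 0 else 0) ∧
      (∀ k : ℕ, 0 < k → η k + η (k - 1) = (if k < n then ξ k else 0)) := by
  refine ⟨alternatingSolution fun k => if k < n then ξ k else 0, fun k =>
    (abs_alternatingSolution_le_sum _ k).trans (sum_abs_truncation_le hξ _), rfl, ?_⟩
  rintro (_ | k) hk
  · exact absurd hk (lt_irrefl 0)
  · simp [alternatingSolution]

/-- for the operator `A : ℓ¹ → ℓ¹`, `(Ax)_k = x_k + x_{k+1}`, whose adjoint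
`A* : ℓ∞ → ℓ∞` is `[A*η]_0 = η_0`, `[A*η]_k = η_k + η_{k−1}` (`k ≥ 1`, 0-based indices):
for every `n` and every `ξ` with `|ξ_k| ≤ 1` for `k < n` there is a bounded sequence `η`
with `sup_k |η_k| ≤ n` and `A*η = (ξ_0, …, ξ_{n−1}, 0, 0, …)`.  In particular Property 1
holds for `A` with `μ = 0` and `γ_n = n`, and every standard unit vector `e^{(j)}`
belongs to the range of `A*`. -/
theorem stmt_17 :
    (∀ n : ℕ, ∀ ξ : ℕ → ℝ, (∀ k < n, |ξ k| ≤ 1) →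
      ∃ η : ℕ → ℝ, (∀ k, |η k| ≤ (n : ℝ)) ∧
        η 0 = (if 0 < n then ξ 0 else 0) ∧
        (∀ k : ℕ, 0 < k → η k + η (k - 1) = (if k < n then ξ k else 0))) ∧
    (∀ j : ℕ, ∃ η : ℕ → ℝ, (∃ C : ℝ, ∀ k, |η k| ≤ C) ∧
      η 0 = (if j = 0 then (1 : ℝ) else 0) ∧
      (∀ k : ℕ, 0 < k → η k + η (k - 1) = (if k = j then (1 : ℝ) else 0))) := by
  refine ⟨exists_bounded_alternating_solution, fun j => ?_⟩
  obtain ⟨η, hbound, hzero, hsucc⟩ := exists_bounded_alternating_solution (j + 1)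
    (fun k => if k = j then 1 else 0) (fun k _ => by split_ifs <;> simp)
  refine ⟨η, ⟨_, hbound⟩, ?_, fun k hk => ?_⟩
  · simpa [eq_comm] using hzero
  · rw [hsucc k hk]
    split_ifs <;> first | rfl | omega
end
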